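/- arXiv:1008.1994 — 11 statements merged into one kernel-verified Lean document; each statement's English description precedes it below -/
import Mathlib

section
/- Let F be a field of characteristic 0 and A an F-algebra (not necessarily associative or unital). If s, t ∈ N_alt(A), then the commutator [s,t] = st − ts also lies in N_alt(A); that is, the generalized alternative nucleus is closed under the commutator. -/
/-- The associator `(x,y,z) = (xy)z - x(yz)`. -/
def assocEl {A : Type*} [NonUnitalNonAssocRing A] (x y z : A) : A :=
  x * y * z - x * (y * z)

/-- The generalized alternative nucleus
`N_alt(A) = { s | (s,x,y) = -(x,s,y) = (x,y,s) for all x, y }`. -/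
def Nalt (A : Type*) [NonUnitalNonAssocRing A] : Set A :=
  {s | ∀ x y : A, assocEl s x y = - assocEl x s y ∧ assocEl x s y = - assocEl x y s}

section TernaryDerivation

open AddMonoid.End

variable {A : Type*} [NonUnitalNonAssocRing A]

theorem addEnd_add_apply (f g : AddMonoid.End A) (x : A) : (f + g) x = f x + g x := rfl

theorem addEnd_sub_apply (f g : AddMonoid.End A) (x : A) : (f - g) x = f x - g x := rfl

theorem addEnd_neg_apply (f : AddMonoid.End A) (x : A) : (-f) x = -f x := rfl

theorem addEnd_mul_apply (f g : AddMonoid.End A) (x : A) : (f * g) x = f (g x) := rfl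

theorem addEnd_mulLeft_apply (s x : A) : mulLeft s x = s * x := rfl

theorem addEnd_mulRight_apply (s x : A) : mulRight s x = x * s := rfl

/-- `(d₁, d₂, d₃)` is a ternary derivation: `d₁ (x y) = (d₂ x) y + x (d₃ y)`. -/
def IsTernaryDerivation (d₁ d₂ d₃ : AddMonoid.End A) : Prop :=
  ∀ x y : A, d₁ (x * y) = d₂ x * y + x * d₃ y

theorem IsTernaryDerivation.add {d₁ d₂ d₃ e₁ e₂ e₃ : AddMonoid.End A}
    (hd : IsTernaryDerivation d₁ d₂ d₃) (he : IsTernaryDerivation e₁ e₂ e₃) :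
    IsTernaryDerivation (d₁ + e₁) (d₂ + e₂) (d₃ + e₃) := by
  intro x y
  simp only [addEnd_add_apply, hd x y, he x y, add_mul, mul_add]
  abel

theorem IsTernaryDerivation.commutator {d₁ d₂ d₃ e₁ e₂ e₃ : AddMonoid.End A}
    (hd : IsTernaryDerivation d₁ d₂ d₃) (he : IsTernaryDerivation e₁ e₂ e₃) :
    IsTernaryDerivation (d₁ * e₁ - e₁ * d₁) (d₂ * e₂ - e₂ * d₂) (d₃ * e₃ - e₃ * d₃) := by
  intro x y
  simp only [addEnd_sub_apply, addEnd_mul_apply, hd _ _, he _ _, map_add, sub_mul, mul_sub]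
  abel

theorem mem_Nalt_iff_isTernaryDerivation (s : A) :
    s ∈ Nalt A ↔
      IsTernaryDerivation (mulLeft s) (mulLeft s + mulRight s) (-mulLeft s) ∧
      IsTernaryDerivation (mulRight s) (-mulRight s) (mulLeft s + mulRight s) := by
  simp only [Nalt, Set.mem_ofPred_eq, IsTernaryDerivation, assocEl, addEnd_add_apply,
    addEnd_neg_apply, addEnd_mulLeft_apply, addEnd_mulRight_apply,
    add_mul, mul_add, neg_mul, mul_neg, ← forall_and]
  refine forall₂_congr fun x y => and_congr ?_ ?_ <;> constructor <;> intro h <;> grind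

theorem mulLeft_commutator {s t : A} (hs : s ∈ Nalt A) (ht : t ∈ Nalt A) :
    mulLeft (s * t - t * s) =
      (mulLeft s * mulLeft t - mulLeft t * mulLeft s) +
      ((mulLeft s * mulRight t - mulRight t * mulLeft s) +
       (mulLeft s * mulRight t - mulRight t * mulLeft s)) := by
  ext x
  have h₁ := (hs t x).1
  have h₂ := (ht s x).2
  have h₃ := (hs t x).2
  have h₄ := (hs x t).1
  have h₅ := (ht s x).1
  simp only [assocEl] at h₁ h₂ h₃ h₄ h₅
  simp only [addEnd_add_apply, addEnd_sub_apply, addEnd_mul_apply,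
    addEnd_mulLeft_apply, addEnd_mulRight_apply, sub_mul]
  grind

theorem mulRight_commutator {s t : A} (hs : s ∈ Nalt A) (ht : t ∈ Nalt A) :
    mulRight (s * t - t * s) =
      (mulRight t * mulRight s - mulRight s * mulRight t) -
      ((mulLeft s * mulRight t - mulRight t * mulLeft s) +
       (mulLeft s * mulRight t - mulRight t * mulLeft s)) := by
  ext x
  have h₁ := (ht x s).2
  have h₂ := (hs x t).1
  have h₃ := (hs x t).2
  have h₄ := (ht s x).2
  simp only [assocEl] at h₁ h₂ h₃ h₄
  simp only [addEnd_add_apply, addEnd_sub_apply, addEnd_mul_apply,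
    addEnd_mulLeft_apply, addEnd_mulRight_apply, mul_sub]
  grind

theorem mulLeft_mulRight_commutator_swap {s t : A} (hs : s ∈ Nalt A) (ht : t ∈ Nalt A) :
    mulLeft s * mulRight t - mulRight t * mulLeft s =
      mulRight s * mulLeft t - mulLeft t * mulRight s := by
  ext x
  have h₁ := (hs x t).1
  have h₂ := (ht x s).1
  have h₃ := (hs x t).2
  simp only [assocEl] at h₁ h₂ h₃
  simp only [addEnd_sub_apply, addEnd_mul_apply, addEnd_mulLeft_apply,
    addEnd_mulRight_apply]
  grind

end TernaryDerivation

/-- the generalized alternative nucleus of a (not necessarily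
associative or unital) algebra over a field of characteristic 0 is closed under
the commutator `[s,t] = st - ts`. -/
theorem nalt_closed_under_commutator
    (F A : Type*) [Field F] [CharZero F]
    [NonUnitalNonAssocRing A] [Module F A] [SMulCommClass F A A] [IsScalarTower F A A]
    (s t : A) (hs : s ∈ Nalt A) (ht : t ∈ Nalt A) :
    s * t - t * s ∈ Nalt A := by
  obtain ⟨hsL, hsR⟩ := (mem_Nalt_iff_isTernaryDerivation s).1 hs
  obtain ⟨htL, htR⟩ := (mem_Nalt_iff_isTernaryDerivation t).1 ht
  have hl := mulLeft_commutator hs ht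
  have hr := mulRight_commutator hs ht
  have hlr := sub_eq_zero.2 (mulLeft_mulRight_commutator_swap hs ht)
  have hleft := (hsL.commutator htL).add ((hsL.commutator htR).add (hsL.commutator htR))
  have hright := (htR.commutator hsR).add ((htR.commutator hsL).add (htR.commutator hsL))
  refine (mem_Nalt_iff_isTernaryDerivation _).2 ⟨?_, ?_⟩
  · convert hleft using 1
    · rw [hl, hr, ← sub_eq_zero, ← hlr]
      noncomm_ring
    · rw [hl]
      noncomm_ring
  · convert hright using 1
    · rw [hr]
      noncomm_ring
    · rw [hr]
      noncomm_ring
    · rw [hl, hr, eq_comm, ← sub_eq_zero, ← hlr]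
      noncomm_ring
end

section
/- Let F be a field of characteristic 0 and A an F-algebra (not necessarily associative or unital). Then N_alt(A), equipped with the commutator [x,y] = xy − yx, is a Malcev algebra: the commutator of two elements of N_alt(A) lies in N_alt(A), the bracket is anticommutative, and it satisfies the Malcev identity [[x,y],[x,z]] = [[[x,y],z],x] + [[[y,z],x],x] + [[[z,x],x],y] for all x, y, z ∈ N_alt(A). -/
/-- The commutator `[x,y] = xy - yx`. -/
def cmm {A : Type*} [NonUnitalNonAssocRing A] (x y : A) : A := x * y - y * x

section AlternativeNucleus

variable {A : Type*} [NonUnitalNonAssocRing A]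

theorem assocEl_teichmuller (w x y z : A) :
    assocEl (w * x) y z - assocEl w (x * y) z + assocEl w x (y * z) =
      w * assocEl x y z + assocEl w x y * z := by
  simp only [assocEl, mul_sub, sub_mul]
  abel

theorem mul_mul_of_mem_nalt {s : A} (hs : s ∈ Nalt A) (x y : A) :
    s * (x * y) = s * x * y + x * s * y - x * (s * y) := by
  have h := (hs x y).1
  simp only [assocEl] at h
  linear_combination (norm := module) -h

theorem mul_mul_of_mem_nalt_right {s : A} (hs : s ∈ Nalt A) (x y : A) :
    x * y * s = x * (s * y) + x * (y * s) - x * s * y := by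
  have h := (hs x y).2
  simp only [assocEl] at h
  linear_combination (norm := module) h

theorem cmm_mul_of_mem_nalt {s t : A} (hs : s ∈ Nalt A) (ht : t ∈ Nalt A) (x : A) :
    cmm s t * x = s * (t * x) - t * (s * x) - 2 • assocEl s x t := by
  have h := (hs t x).1
  have h' := (ht s x).2
  simp only [cmm, assocEl, sub_mul] at *
  linear_combination (norm := module) 2 • h' - h

theorem mul_cmm_of_mem_nalt {s : A} (hs : s ∈ Nalt A) (t x : A) :
    x * cmm s t = x * s * t - x * t * s + 2 • assocEl s x t := by
  have h := hs x t
  simp only [cmm, assocEl, mul_sub] at *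
  linear_combination (norm := module) h.2 - 2 • h.1

/-- On the nucleus the Jacobian of the commutator is six times the associator. -/
theorem cmm_cyclic_sum {x y z : A} (hx : x ∈ Nalt A) (hy : y ∈ Nalt A) (hz : z ∈ Nalt A) :
    cmm (cmm x y) z + cmm (cmm y z) x + cmm (cmm z x) y = 6 • assocEl x y z := by
  have h1 := hx y z
  have h2 := hx z y
  have h3 := hy x z
  have h4 := hy z x
  have h5 := hz x y
  have h6 := hz y x
  have e : cmm (cmm x y) z + cmm (cmm y z) x + cmm (cmm z x) y =
      assocEl x y z + assocEl y z x + assocEl z x y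
        - assocEl x z y - assocEl y x z - assocEl z y x := by
    simp only [cmm, assocEl, mul_sub, sub_mul]
    abel
  rw [e]
  grind

theorem assocEl_mul_of_mem_nalt {s t : A} (hs : s ∈ Nalt A) (ht : t ∈ Nalt A) (x y : A) :
    assocEl s (x * y) t = assocEl s x t * y + x * assocEl s y t - assocEl x (cmm s t) y := by
  have e1 : s * (x * y * t) = s * (x * (t * y)) + s * (x * (y * t)) - s * (x * t * y) := by
    rw [mul_mul_of_mem_nalt_right ht x y, mul_sub, mul_add]
  have e2 : s * (x * y) * t = s * x * y * t + x * s * y * t - x * (s * y) * t := by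
    rw [mul_mul_of_mem_nalt hs x y, sub_mul, add_mul]
  rw [mul_mul_of_mem_nalt hs x (t * y), mul_mul_of_mem_nalt hs x (y * t),
    mul_mul_of_mem_nalt hs (x * t) y] at e1
  rw [mul_mul_of_mem_nalt_right ht (s * x) y, mul_mul_of_mem_nalt_right ht (x * s) y,
    mul_mul_of_mem_nalt_right ht x (s * y)] at e2
  have c1 := congrArg (· * y) (mul_cmm_of_mem_nalt hs t x)
  have c2 := congrArg (x * ·) (cmm_mul_of_mem_nalt hs ht y)
  simp only [assocEl, mul_sub, sub_mul, mul_add, add_mul, two_smul] at *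
  linear_combination (norm := module) e2 - e1 + c1 - c2

theorem assocEl_swap_of_mem_nalt {s t : A} (hs : s ∈ Nalt A) (ht : t ∈ Nalt A) (x : A) :
    assocEl t x s = -assocEl s x t := by
  have h := hs t x
  rw [← (ht s x).2, h.1, h.2, neg_neg]

theorem assocEl_cmm_left {s t : A} (hs : s ∈ Nalt A) (ht : t ∈ Nalt A) (x y : A) :
    assocEl (cmm s t) x y = -assocEl x (cmm s t) y := by
  have e1 : s * (t * (x * y)) = s * (t * x * y) + s * (x * t * y) - s * (x * (t * y)) := by
    rw [mul_mul_of_mem_nalt ht x y, mul_sub, mul_add]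
  have e2 : t * (s * (x * y)) = t * (s * x * y) + t * (x * s * y) - t * (x * (s * y)) := by
    rw [mul_mul_of_mem_nalt hs x y, mul_sub, mul_add]
  rw [mul_mul_of_mem_nalt hs (t * x) y, mul_mul_of_mem_nalt hs (x * t) y,
    mul_mul_of_mem_nalt hs x (t * y)] at e1
  rw [mul_mul_of_mem_nalt ht (s * x) y, mul_mul_of_mem_nalt ht (x * s) y,
    mul_mul_of_mem_nalt ht x (s * y)] at e2
  have h := assocEl_mul_of_mem_nalt hs ht x y
  have c := cmm_mul_of_mem_nalt hs ht (x * y)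
  have c1 := congrArg (· * y) (mul_cmm_of_mem_nalt hs t x)
  have c2 := congrArg (x * ·) (cmm_mul_of_mem_nalt hs ht y)
  have c3 := congrArg (· * y) (cmm_mul_of_mem_nalt hs ht x)
  have r := congrArg (· * y) (assocEl_swap_of_mem_nalt hs ht x)
  simp only [assocEl, mul_sub, sub_mul, mul_add, add_mul, two_smul, neg_sub] at *
  linear_combination (norm := module) c3 - c - e1 + e2 + 2 • h - c1 + c2 - r

theorem assocEl_cmm_right {s t : A} (hs : s ∈ Nalt A) (ht : t ∈ Nalt A) (x y : A) :
    assocEl x y (cmm s t) = -assocEl x (cmm s t) y := by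
  have e1 : x * y * t * s = x * (t * y) * s + x * (y * t) * s - x * t * y * s := by
    rw [mul_mul_of_mem_nalt_right ht x y, sub_mul, add_mul]
  have e2 : x * y * s * t = x * (s * y) * t + x * (y * s) * t - x * s * y * t := by
    rw [mul_mul_of_mem_nalt_right hs x y, sub_mul, add_mul]
  rw [mul_mul_of_mem_nalt_right hs x (t * y), mul_mul_of_mem_nalt_right hs x (y * t),
    mul_mul_of_mem_nalt_right hs (x * t) y] at e1
  rw [mul_mul_of_mem_nalt_right ht x (s * y), mul_mul_of_mem_nalt_right ht x (y * s),
    mul_mul_of_mem_nalt_right ht (x * s) y] at e2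
  have h := assocEl_mul_of_mem_nalt hs ht x y
  have c := mul_cmm_of_mem_nalt hs t (x * y)
  have c1 := congrArg (· * y) (mul_cmm_of_mem_nalt hs t x)
  have c2 := congrArg (x * ·) (cmm_mul_of_mem_nalt hs ht y)
  have c3 := congrArg (x * ·) (mul_cmm_of_mem_nalt hs t y)
  have r := congrArg (x * ·) (assocEl_swap_of_mem_nalt hs ht y)
  simp only [assocEl, mul_sub, sub_mul, mul_add, add_mul, two_smul, neg_sub] at *
  linear_combination (norm := module) c - c3 + e2 - e1 + 2 • h - c1 + c2 - r

theorem cmm_mem_nalt {s t : A} (hs : s ∈ Nalt A) (ht : t ∈ Nalt A) : cmm s t ∈ Nalt A :=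
  fun x y => ⟨assocEl_cmm_left hs ht x y, by rw [assocEl_cmm_right hs ht, neg_neg]⟩

theorem two_smul_assocEl_self {s : A} (hs : s ∈ Nalt A) (x : A) : 2 • assocEl s x s = 0 := by
  linear_combination (norm := module) 2 • (hs x s).1 - (hs x s).2

theorem two_smul_assocEl_cmm {x y z : A} (hx : x ∈ Nalt A) (hy : y ∈ Nalt A) (hz : z ∈ Nalt A) :
    2 • assocEl x y (cmm x z) = 2 • cmm (assocEl x y z) x := by
  have t := assocEl_teichmuller x y x z
  have t' := assocEl_teichmuller x z y x
  have t'' := assocEl_teichmuller x z x y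
  have g₁ : assocEl z y x = -assocEl x y z := by grind [hx z y, hy x z]
  have g₂ : assocEl y x z = -assocEl x y z := by grind [hx y z]
  have g₃ : assocEl z x y = assocEl x y z := by grind [hx z y, hy x z]
  have g₄ : assocEl x z y = -assocEl x y z := by grind [hy x z]
  have n₁ : 2 • (assocEl x y x * z) = 0 := by
    rw [← smul_mul_assoc, two_smul_assocEl_self hx, zero_mul]
  have n₂ : 2 • (assocEl x z x * y) = 0 := by
    rw [← smul_mul_assoc, two_smul_assocEl_self hx, zero_mul]
  have n₃ := two_smul_assocEl_self hx (z * y)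
  have p₁ : assocEl (x * y) x z = assocEl x z (x * y) := by grind [hx (x * y) z, hz x (x * y)]
  have p₂ : assocEl x (y * x) z = -assocEl x z (y * x) := by grind [hz x (y * x)]
  have p₃ : assocEl (x * z) y x = -assocEl x y (x * z) := by grind [hx (x * z) y, hy x (x * z)]
  have p₄ : assocEl (x * z) x y = assocEl x y (x * z) := by grind [hx (x * z) y, hy x (x * z)]
  have p₅ : assocEl x (z * x) y = -assocEl x y (z * x) := by grind [hy x (z * x)]
  have e : assocEl x y (cmm x z) = assocEl x y (x * z) - assocEl x y (z * x) := by
    simp only [assocEl, cmm, mul_sub]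
    abel
  simp only [g₁, g₂, g₃, g₄, p₁, p₂, p₃, p₄, p₅, mul_neg, neg_mul] at t t' t''
  rw [e, cmm]
  linear_combination (norm := module) 2 • t - 2 • t' - 2 • t'' + n₁ - n₂ - n₃

theorem malcev_identity_of_mem_nalt {x y z : A}
    (hx : x ∈ Nalt A) (hy : y ∈ Nalt A) (hz : z ∈ Nalt A) :
    cmm (cmm x y) (cmm x z) =
      cmm (cmm (cmm x y) z) x + cmm (cmm (cmm y z) x) x + cmm (cmm (cmm z x) x) y := by
  have h1 := congrArg (cmm · x) (cmm_cyclic_sum hx hy hz)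
  have h2 := cmm_cyclic_sum hx hy (cmm_mem_nalt hx hz)
  have h3 : 6 • assocEl x y (cmm x z) = 6 • cmm (assocEl x y z) x := by
    linear_combination (norm := module) 3 • two_smul_assocEl_cmm hx hy hz
  have h4 : cmm (6 • assocEl x y z) x = 6 • cmm (assocEl x y z) x := by
    simp only [cmm, smul_mul_assoc, mul_smul_comm, smul_sub]
  rw [h3, ← h4, ← h1] at h2
  simp only [cmm, mul_sub, sub_mul, mul_add, add_mul] at *
  linear_combination (norm := module) h2

end AlternativeNucleus

/-- `N_alt(A)`, equipped with the commutator, is a Malcev algebra: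
it is closed under the commutator, the commutator is anticommutative, and the
Malcev identity holds on `N_alt(A)`. -/
theorem nalt_is_malcev
    (F A : Type*) [Field F] [CharZero F]
    [NonUnitalNonAssocRing A] [Module F A] [SMulCommClass F A A] [IsScalarTower F A A] :
    (∀ s t : A, s ∈ Nalt A → t ∈ Nalt A → cmm s t ∈ Nalt A) ∧
    (∀ s t : A, cmm s t = - cmm t s) ∧
    (∀ x y z : A, x ∈ Nalt A → y ∈ Nalt A → z ∈ Nalt A →
      cmm (cmm x y) (cmm x z) =
        cmm (cmm (cmm x y) z) x + cmm (cmm (cmm y z) x) x + cmm (cmm (cmm z x) x) y) := by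
  refine ⟨fun s t hs ht => cmm_mem_nalt hs ht, fun s t => ?_,
    fun x y z hx hy hz => malcev_identity_of_mem_nalt hx hy hz⟩
  simp only [cmm, neg_sub]
end

section
/- Let F be a field of characteristic 0 and A an F-algebra (not necessarily associative or unital). For all s, t ∈ N_alt(A) and all x ∈ A, the associator satisfies (s,t,x) = (1/6)[[x,s],t] − (1/6)[[x,t],s] − (1/6)[x,[s,t]]. -/
/-- The Jacobiator of the commutator is the alternating sum of the associators. -/
theorem cmm_jacobi {A : Type*} [NonUnitalNonAssocRing A] (s t x : A) :
    cmm (cmm x s) t - cmm (cmm x t) s - cmm x (cmm s t) =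
      assocEl s t x - assocEl t s x + assocEl t x s - assocEl s x t
        + assocEl x s t - assocEl x t s := by
  simp only [cmm, assocEl, mul_sub, sub_mul]
  abel

/-- for `s, t ∈ N_alt(A)` and `x ∈ A`,
`(s,t,x) = (1/6)[[x,s],t] - (1/6)[[x,t],s] - (1/6)[x,[s,t]]`. -/
theorem assoc_of_nalt_pair
    (F A : Type*) [Field F] [CharZero F]
    [NonUnitalNonAssocRing A] [Module F A] [SMulCommClass F A A] [IsScalarTower F A A]
    (s t : A) (hs : s ∈ Nalt A) (ht : t ∈ Nalt A) (x : A) :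
    assocEl s t x =
      (1/6 : F) • cmm (cmm x s) t - (1/6 : F) • cmm (cmm x t) s
        - (1/6 : F) • cmm x (cmm s t) := by
  obtain ⟨hs₁, hs₂⟩ := hs t x
  obtain ⟨-, hs₃⟩ := hs x t
  obtain ⟨-, ht₁⟩ := ht s x
  obtain ⟨ht₂, -⟩ := ht x s
  have hts : assocEl t s x = -assocEl s t x := by rw [hs₁, neg_neg]
  have htx : assocEl t x s = assocEl s t x := by rw [hs₁, hs₂, neg_neg]
  have hsx : assocEl s x t = -assocEl s t x := by rw [ht₁, neg_neg]
  have hxt : assocEl x t s = -assocEl s t x := by rw [← htx, ht₂, neg_neg]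
  have hxs : assocEl x s t = assocEl s t x := by rw [hs₃, hxt, neg_neg]
  rw [← smul_sub, ← smul_sub, cmm_jacobi, eq_comm, one_div, inv_smul_eq_iff₀ (by norm_num),
    hts, htx, hsx, hxs, hxt]
  module
end

section
/- Let F be a field of characteristic 0 and A an F-algebra (not necessarily associative or unital). For all s, t ∈ N_alt(A), the following identities of F-linear operators on A hold: [L_s, L_t] = L_{[s,t]} − 2[R_s, L_t]; [R_s, R_t] = −R_{[s,t]} − 2[L_s, R_t]; and [L_s, R_t] = [R_s, L_t]. -/
/-- The commutator of two linear operators. -/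
def opComm {F A : Type*} [Field F] [AddCommGroup A] [Module F A]
    (f g : Module.End F A) : Module.End F A := f * g - g * f

/-- for `s, t ∈ N_alt(A)`,
`[L_s, L_t] = L_{[s,t]} - 2[R_s, L_t]`, `[R_s, R_t] = -R_{[s,t]} - 2[L_s, R_t]`,
and `[L_s, R_t] = [R_s, L_t]`. -/
theorem operator_commutator_identities
    (F A : Type*) [Field F] [CharZero F]
    [NonUnitalNonAssocRing A] [Module F A] [SMulCommClass F A A] [IsScalarTower F A A]
    (s t : A) (hs : s ∈ Nalt A) (ht : t ∈ Nalt A) :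
    (opComm (LinearMap.mulLeft F s) (LinearMap.mulLeft F t) =
      LinearMap.mulLeft F (s * t - t * s)
        - (2 : F) • opComm (LinearMap.mulRight F s) (LinearMap.mulLeft F t)) ∧
    (opComm (LinearMap.mulRight F s) (LinearMap.mulRight F t) =
      - LinearMap.mulRight F (s * t - t * s)
        - (2 : F) • opComm (LinearMap.mulLeft F s) (LinearMap.mulRight F t)) ∧
    (opComm (LinearMap.mulLeft F s) (LinearMap.mulRight F t) =
      opComm (LinearMap.mulRight F s) (LinearMap.mulLeft F t)) := by
  have hs₁ : ∀ x y : A, assocEl s x y = -assocEl x s y := fun x y => (hs x y).1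
  have hs₂ : ∀ x y : A, assocEl x s y = -assocEl x y s := fun x y => (hs x y).2
  have ht₁ : ∀ x y : A, assocEl t x y = -assocEl x t y := fun x y => (ht x y).1
  simp only [assocEl] at hs₁ hs₂ ht₁
  refine ⟨?_, ?_, ?_⟩ <;> ext x <;>
    simp only [opComm, two_smul, LinearMap.sub_apply, LinearMap.add_apply, LinearMap.neg_apply,
      Module.End.mul_apply, LinearMap.mulLeft_apply, LinearMap.mulRight_apply, sub_mul, mul_sub]
  · linear_combination (norm := abel) -hs₁ t x + 2 • hs₂ t x
  · linear_combination (norm := abel) hs₂ x t - 2 • hs₁ x t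
  · linear_combination (norm := abel) -hs₁ x t + hs₂ x t - ht₁ x s
end

section
/- Let F be a field of characteristic 0 and A an F-algebra (not necessarily associative or unital). For all s, t ∈ N_alt(A): the operator D_{s,t} = [L_s,L_t] + [L_s,R_t] + [R_s,R_t] is a derivation of A, i.e. D_{s,t}(xy) = D_{s,t}(x)y + x D_{s,t}(y) for all x, y ∈ A; moreover D_{s,t} = −ad_{[s,t]} − 3[L_s, R_t] and 2 D_{s,t} = −ad_{[s,t]} + [ad_s, ad_t] as operators on A. -/
/-- `ad_s = R_s - L_s`. -/
def adOp (F : Type*) {A : Type*} [Field F]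
    [NonUnitalNonAssocRing A] [Module F A] [SMulCommClass F A A] [IsScalarTower F A A]
    (s : A) : Module.End F A :=
  LinearMap.mulRight F s - LinearMap.mulLeft F s

/-- `D_{s,t} = [L_s,L_t] + [L_s,R_t] + [R_s,R_t]`. -/
def Dop (F : Type*) {A : Type*} [Field F]
    [NonUnitalNonAssocRing A] [Module F A] [SMulCommClass F A A] [IsScalarTower F A A]
    (s t : A) : Module.End F A :=
  opComm (LinearMap.mulLeft F s) (LinearMap.mulLeft F t)
    + opComm (LinearMap.mulLeft F s) (LinearMap.mulRight F t)
    + opComm (LinearMap.mulRight F s) (LinearMap.mulRight F t)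

section GeneralizedAlternativeNucleus

open LinearMap

variable {F A : Type*} [Field F]

/-- If `f` and `f'` satisfy `f (xy) = g(x) y + x h(y)` and `f' (xy) = g'(x) y + x h'(y)`, then
their commutator satisfies the same kind of rule, with the commutators of the companions. -/
theorem opComm_apply_mul [NonUnitalNonAssocRing A] [Module F A] {f g h f' g' h' : Module.End F A}
    (H : ∀ x y : A, f (x * y) = g x * y + x * h y)
    (H' : ∀ x y : A, f' (x * y) = g' x * y + x * h' y) (x y : A) :
    opComm f f' (x * y) = opComm g g' x * y + x * opComm h h' y := by
  simp only [opComm, LinearMap.sub_apply, Module.End.mul_apply, H, H', map_add, mul_sub, sub_mul]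
  abel

theorem opComm_add_left [AddCommGroup A] [Module F A] (f g h : Module.End F A) :
    opComm (f + g) h = opComm f h + opComm g h := by
  simp only [opComm]
  noncomm_ring

theorem opComm_add_right [AddCommGroup A] [Module F A] (f g h : Module.End F A) :
    opComm f (g + h) = opComm f g + opComm f h := by
  simp only [opComm]
  noncomm_ring

theorem opComm_neg_left [AddCommGroup A] [Module F A] (f g : Module.End F A) :
    opComm (-f) g = -opComm f g := by
  simp only [opComm]
  noncomm_ring

theorem opComm_neg_right [AddCommGroup A] [Module F A] (f g : Module.End F A) :
    opComm f (-g) = -opComm f g := by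
  simp only [opComm]
  noncomm_ring

variable [NonUnitalNonAssocRing A] [Module F A] [SMulCommClass F A A] [IsScalarTower F A A]
  {s t : A}

theorem mulLeft_apply_mul_of_mem_Nalt (hs : s ∈ Nalt A) (x y : A) :
    mulLeft F s (x * y) = (mulLeft F s + mulRight F s) x * y + x * (-mulLeft F s) y := by
  have h := (hs x y).1
  simp only [assocEl] at h
  simp only [mulLeft_apply, mulRight_apply, LinearMap.add_apply, LinearMap.neg_apply, add_mul,
    mul_neg]
  linear_combination (norm := module) -h

theorem mulRight_apply_mul_of_mem_Nalt (hs : s ∈ Nalt A) (x y : A) :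
    mulRight F s (x * y) = (-mulRight F s) x * y + x * (mulLeft F s + mulRight F s) y := by
  have h := (hs x y).2
  simp only [assocEl] at h
  simp only [mulLeft_apply, mulRight_apply, LinearMap.add_apply, LinearMap.neg_apply, mul_add,
    neg_mul]
  linear_combination (norm := module) h

theorem opComm_mulRight_mulLeft (hs : s ∈ Nalt A) (ht : t ∈ Nalt A) :
    opComm (mulRight F s) (mulLeft F t) = opComm (mulLeft F s) (mulRight F t) := by
  ext x
  have h₁ := (hs t x).1
  have h₂ := (hs t x).2
  have h₃ := (ht s x).2
  simp only [assocEl] at h₁ h₂ h₃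
  simp only [opComm, LinearMap.sub_apply, Module.End.mul_apply, mulLeft_apply, mulRight_apply]
  linear_combination (norm := module) h₂ + h₃ - h₁

theorem opComm_mulLeft_mulLeft (hs : s ∈ Nalt A) (ht : t ∈ Nalt A) :
    opComm (mulLeft F s) (mulLeft F t) =
      mulLeft F (s * t - t * s) - (2 : F) • opComm (mulLeft F s) (mulRight F t) := by
  ext x
  have h₁ := (hs t x).1
  have h₂ := (ht s x).2
  simp only [assocEl] at h₁ h₂
  simp only [opComm, LinearMap.sub_apply, Module.End.mul_apply, mulLeft_apply, mulRight_apply,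
    LinearMap.smul_apply, sub_mul]
  linear_combination (norm := module) h₁ - (2 : F) • h₂

theorem opComm_mulRight_mulRight (hs : s ∈ Nalt A) (t : A) :
    opComm (mulRight F s) (mulRight F t) =
      -mulRight F (s * t - t * s) - (2 : F) • opComm (mulLeft F s) (mulRight F t) := by
  ext x
  have h₁ := (hs x t).1
  have h₂ := (hs x t).2
  simp only [assocEl] at h₁ h₂
  simp only [opComm, LinearMap.sub_apply, Module.End.mul_apply, mulLeft_apply, mulRight_apply,
    LinearMap.smul_apply, LinearMap.neg_apply, mul_sub]
  linear_combination (norm := module) h₂ - (2 : F) • h₁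

theorem Dop_apply_mul (hs : s ∈ Nalt A) (ht : t ∈ Nalt A) (x y : A) :
    Dop F s t (x * y) = Dop F s t x * y + x * Dop F s t y := by
  have hL := mulLeft_apply_mul_of_mem_Nalt (F := F) hs
  have hR := mulRight_apply_mul_of_mem_Nalt (F := F) hs
  have hL' := mulLeft_apply_mul_of_mem_Nalt (F := F) ht
  have hR' := mulRight_apply_mul_of_mem_Nalt (F := F) ht
  simp only [Dop, LinearMap.add_apply]
  rw [opComm_apply_mul hL hL', opComm_apply_mul hL hR', opComm_apply_mul hR hR']
  simp only [opComm_add_left, opComm_add_right, opComm_neg_left, opComm_neg_right,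
    opComm_mulRight_mulLeft hs ht, LinearMap.add_apply, LinearMap.neg_apply, add_mul, mul_add,
    neg_mul, mul_neg]
  abel

end GeneralizedAlternativeNucleus

/-- for `s, t ∈ N_alt(A)`, the operator `D_{s,t}` is a derivation of `A`,
`D_{s,t} = -ad_{[s,t]} - 3[L_s, R_t]`, and `2D_{s,t} = -ad_{[s,t]} + [ad_s, ad_t]`. -/
theorem Dst_is_derivation_and_identities
    (F A : Type*) [Field F] [CharZero F]
    [NonUnitalNonAssocRing A] [Module F A] [SMulCommClass F A A] [IsScalarTower F A A]
    (s t : A) (hs : s ∈ Nalt A) (ht : t ∈ Nalt A) :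
    (∀ x y : A, Dop F s t (x * y) = Dop F s t x * y + x * Dop F s t y) ∧
    (Dop F s t = - adOp F (s * t - t * s)
      - (3 : F) • opComm (LinearMap.mulLeft F s) (LinearMap.mulRight F t)) ∧
    ((2 : F) • Dop F s t = - adOp F (s * t - t * s) + opComm (adOp F s) (adOp F t)) := by
  have hRL := opComm_mulRight_mulLeft (F := F) hs ht
  have hLL := opComm_mulLeft_mulLeft (F := F) hs ht
  have hRR := opComm_mulRight_mulRight (F := F) hs t
  refine ⟨Dop_apply_mul hs ht, ?_, ?_⟩
  · rw [Dop, adOp, hLL, hRR]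
    module
  · have had : opComm (adOp F s) (adOp F t) =
        opComm (LinearMap.mulRight F s) (LinearMap.mulRight F t)
          + opComm (LinearMap.mulLeft F s) (LinearMap.mulLeft F t)
          - (2 : F) • opComm (LinearMap.mulLeft F s) (LinearMap.mulRight F t) := by
      simp only [adOp, sub_eq_add_neg, opComm_add_left, opComm_add_right, opComm_neg_left,
        opComm_neg_right, hRL]
      module
    rw [had, Dop, adOp, hLL, hRR]
    module
end

section
/- Let F be a field of characteristic 0 and A an F-algebra (not necessarily associative or unital). For all s, t ∈ N_alt(A) and all y ∈ A: (i) [ty, s] = [t,s]y + t[y,s] − D_{s,t}(y) − [y,[s,t]]; and (ii) s(ty) = t(sy) + [s,t]y + (2/3) D_{s,t}(y) + (2/3)[y,[s,t]]. -/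
/-- If the associator alternates on the entries `s`, `t`, `y`, then
`D_{s,t}(y) + [y,[s,t]] = -3 (s,t,y)`. -/
theorem Dop_add_cmm_cmm {F A : Type*} [Field F]
    [NonUnitalNonAssocRing A] [Module F A] [SMulCommClass F A A] [IsScalarTower F A A]
    {s t y : A} (hts : assocEl t s y = -assocEl s t y) (hsy : assocEl s y t = -assocEl s t y)
    (hys : assocEl y s t = assocEl s t y) (hyt : assocEl y t s = -assocEl s t y) :
    Dop F s t y + cmm y (cmm s t) = (-3 : ℤ) • assocEl s t y := by
  have key : Dop F s t y + cmm y (cmm s t) =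
      assocEl t s y - assocEl s t y - assocEl s y t + assocEl y t s - assocEl y s t := by
    simp only [Dop, opComm, cmm, assocEl, LinearMap.add_apply, LinearMap.sub_apply,
      Module.End.mul_apply, LinearMap.mulLeft_apply, LinearMap.mulRight_apply, mul_sub, sub_mul]
    abel
  rw [key, hts, hsy, hys, hyt]
  abel

/-- If the associator alternates on the entries `s`, `t`, `y`, then
`[ty,s] = [t,s]y + t[y,s] - D_{s,t}(y) - [y,[s,t]]`. -/
theorem cmm_mul_left_of_alternating (F : Type*) {A : Type*} [Field F]
    [NonUnitalNonAssocRing A] [Module F A] [SMulCommClass F A A] [IsScalarTower F A A]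
    {s t y : A} (hts : assocEl t s y = -assocEl s t y) (hsy : assocEl s y t = -assocEl s t y)
    (hys : assocEl y s t = assocEl s t y) (hyt : assocEl y t s = -assocEl s t y)
    (hty : assocEl t y s = assocEl s t y) :
    cmm (t * y) s = cmm t s * y + t * cmm y s - Dop F s t y - cmm y (cmm s t) := by
  have key : cmm (t * y) s =
      cmm t s * y + t * cmm y s + (assocEl t y s + assocEl s t y - assocEl t s y) := by
    simp only [cmm, assocEl, mul_sub, sub_mul]
    abel
  rw [sub_sub, Dop_add_cmm_cmm hts hsy hys hyt, key, hty, hts]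
  abel

/-- If the associator alternates on the entries `s`, `t`, `y`, then
`s(ty) = t(sy) + [s,t]y + (2/3) D_{s,t}(y) + (2/3) [y,[s,t]]`. -/
theorem mul_mul_left_of_alternating (F : Type*) {A : Type*} [Field F] [CharZero F]
    [NonUnitalNonAssocRing A] [Module F A] [SMulCommClass F A A] [IsScalarTower F A A]
    {s t y : A} (hts : assocEl t s y = -assocEl s t y) (hsy : assocEl s y t = -assocEl s t y)
    (hys : assocEl y s t = assocEl s t y) (hyt : assocEl y t s = -assocEl s t y) :
    s * (t * y) =
      t * (s * y) + cmm s t * y + (2/3 : F) • Dop F s t y + (2/3 : F) • cmm y (cmm s t) := by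
  have key : s * (t * y) =
      t * (s * y) + cmm s t * y + (assocEl t s y - assocEl s t y) := by
    simp only [cmm, assocEl, sub_mul]
    abel
  have hscalar : (2/3 : F) • (-3 : ℤ) • assocEl s t y = (-2 : ℤ) • assocEl s t y := by
    rw [← Int.cast_smul_eq_zsmul F, ← Int.cast_smul_eq_zsmul F, smul_smul]
    congr 1
    norm_num
  rw [add_assoc _ ((2/3 : F) • Dop F s t y), ← smul_add, Dop_add_cmm_cmm hts hsy hys hyt,
    hscalar, key, hts]
  abel

/-- for `s, t ∈ N_alt(A)` and `y ∈ A`,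
(i)  `[ty,s] = [t,s]y + t[y,s] - D_{s,t}(y) - [y,[s,t]]`;
(ii) `s(ty) = t(sy) + [s,t]y + (2/3)D_{s,t}(y) + (2/3)[y,[s,t]]`. -/
theorem bracket_and_left_product_via_Dst
    (F A : Type*) [Field F] [CharZero F]
    [NonUnitalNonAssocRing A] [Module F A] [SMulCommClass F A A] [IsScalarTower F A A]
    (s t : A) (hs : s ∈ Nalt A) (ht : t ∈ Nalt A) (y : A) :
    (cmm (t * y) s =
      cmm t s * y + t * cmm y s - Dop F s t y - cmm y (cmm s t)) ∧
    (s * (t * y) =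
      t * (s * y) + cmm s t * y + (2/3 : F) • Dop F s t y
        + (2/3 : F) • cmm y (cmm s t)) := by
  obtain ⟨hst₁, hst₂⟩ := hs t y
  obtain ⟨hsy₁, hsy₂⟩ := hs y t
  obtain ⟨-, hts⟩ := ht s y
  have hsy : assocEl s y t = -assocEl s t y := by rw [hts, neg_neg]
  have hst : assocEl t s y = -assocEl s t y := by rw [hst₁, neg_neg]
  have hys : assocEl y s t = assocEl s t y := by rw [hts, hsy₁, neg_neg]
  have hyt : assocEl y t s = -assocEl s t y := by rw [← hys, hsy₂, neg_neg]
  have hty : assocEl t y s = assocEl s t y := by rw [hst₁, hst₂, neg_neg]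
  exact ⟨cmm_mul_left_of_alternating F hst hsy hys hyt hty,
    mul_mul_left_of_alternating F hst hsy hys hyt⟩
end

section
/- Let F be a field of characteristic 0 and A an F-algebra (not necessarily associative or unital). Let s ∈ N_alt(A) and define powers of s recursively by s^1 = s and s^{m+1} = s·(s^m). Then [R_s, L_s] = 0, and L_{s^m} = (L_s)^m as F-linear operators on A, for every m ≥ 1. -/
/-- The associator is unchanged when an element of `Nalt A` is moved cyclically. -/
theorem assocEl_rotate_of_mem_Nalt {A : Type*} [NonUnitalNonAssocRing A] {s : A}
    (hs : s ∈ Nalt A) (x y : A) : assocEl s x y = assocEl x y s := by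
  rw [(hs x y).1, (hs x y).2, neg_neg]

/-- Elements of `Nalt A` are flexible when the scalars have characteristic zero. -/
theorem mul_mul_comm_of_mem_Nalt (F : Type*) {A : Type*} [Field F] [CharZero F]
    [NonUnitalNonAssocRing A] [Module F A] {s : A} (hs : s ∈ Nalt A) (x : A) :
    s * x * s = s * (x * s) := by
  have h2 : (2 : F) • assocEl x s s = 0 := by
    rw [two_smul]
    exact eq_neg_iff_add_eq_zero.mp (hs x s).2
  have h0 : assocEl x s s = 0 := (smul_eq_zero.mp h2).resolve_left two_ne_zero
  have h : assocEl s x s = 0 := by rw [(hs x s).1, h0, neg_zero]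
  exact sub_eq_zero.mp h

/-- let `s ∈ N_alt(A)` and let `p m = s^m` be the powers of `s`
defined recursively by `s^1 = s` and `s^{m+1} = s·(s^m)`.  Then `[R_s, L_s] = 0`
and `L_{s^m} = (L_s)^m` for every `m ≥ 1`. -/
theorem left_mul_of_powers
    (F A : Type*) [Field F] [CharZero F]
    [NonUnitalNonAssocRing A] [Module F A] [SMulCommClass F A A] [IsScalarTower F A A]
    (s : A) (hs : s ∈ Nalt A)
    (p : ℕ → A) (hp1 : p 1 = s) (hpsucc : ∀ m : ℕ, 1 ≤ m → p (m + 1) = s * p m) :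
    (LinearMap.mulRight F s * LinearMap.mulLeft F s
      - LinearMap.mulLeft F s * LinearMap.mulRight F s = 0) ∧
    (∀ m : ℕ, 1 ≤ m → LinearMap.mulLeft F (p m) = (LinearMap.mulLeft F s) ^ m) := by
  have hcomm : Commute (LinearMap.mulRight F s) (LinearMap.mulLeft F s) :=
    LinearMap.ext fun x => mul_mul_comm_of_mem_Nalt F hs x
  refine ⟨sub_eq_zero.mpr hcomm.eq, fun m hm => ?_⟩
  induction m, hm using Nat.le_induction with
  | base => rw [hp1, pow_one]
  | succ m hm ih =>
    have hR : Commute (LinearMap.mulRight F s) (LinearMap.mulLeft F (p m)) :=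
      ih ▸ hcomm.pow_right m
    rw [hpsucc m hm, pow_succ', ← ih]
    ext y
    have hy : p m * y * s = p m * (y * s) := LinearMap.congr_fun hR.eq y
    have h : assocEl s (p m) y = 0 :=
      (assocEl_rotate_of_mem_Nalt hs (p m) y).trans (sub_eq_zero.mpr hy)
    exact sub_eq_zero.mp h
end

section
/- Let F be a field of characteristic 0 and A an F-algebra (not necessarily associative or unital). For s ∈ N_alt(A), x ∈ A and every integer k ≥ 0, the following identity of F-linear operators on A holds: L_{(L_s)^k(x)} = Σ_{q=0}^{k} C(k,q) · (L_s)^{k−q} ∘ (ad_{R_s})^q(L_x), where ad_{R_s}(T) = R_s ∘ T − T ∘ R_s for an operator T, (ad_{R_s})^q denotes q-fold iteration, and C(k,q) is a binomial coefficient. -/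
/-- For `s` in the generalized alternative nucleus, `(s,x,s) = 0`. -/
theorem assocEl_self_mid_self_eq_zero (F : Type*) {A : Type*} [Field F] [CharZero F]
    [NonUnitalNonAssocRing A] [Module F A] {s : A} (hs : s ∈ Nalt A) (x : A) :
    assocEl s x s = 0 := by
  have : IsAddTorsionFree A := .of_isTorsionFree F A
  obtain ⟨h₁, h₂⟩ := hs x s
  rw [h₁, self_eq_neg.mp h₂, neg_zero]

section

variable (F : Type*) {A : Type*} [Field F] [NonUnitalNonAssocRing A] [Module F A]
  [SMulCommClass F A A] [IsScalarTower F A A]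

open LinearMap

theorem commute_mulLeft_mulRight_of_mem_Nalt [CharZero F] {s : A} (hs : s ∈ Nalt A) :
    Commute (mulLeft F s) (mulRight F s) := by
  refine LinearMap.ext fun x => ?_
  exact (sub_eq_zero.mp (assocEl_self_mid_self_eq_zero F hs x)).symm

theorem mulLeft_mul_of_mem_Nalt {s : A} (hs : s ∈ Nalt A) (x : A) :
    mulLeft F (s * x) =
      mulRight F s * mulLeft F x - mulLeft F x * mulRight F s + mulLeft F s * mulLeft F x := by
  refine LinearMap.ext fun y => ?_
  obtain ⟨h₁, h₂⟩ := hs x y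
  have h : s * x * y - s * (x * y) = x * y * s - x * (y * s) := by
    have h₃ : assocEl s x y = assocEl x y s := by rw [h₁, h₂, neg_neg]
    exact h₃
  exact sub_eq_iff_eq_add.mp h

end

/-- for `s ∈ N_alt(A)`, `x ∈ A`, and `k ≥ 0`,
`L_{(L_s)^k(x)} = Σ_{q=0}^{k} C(k,q) (L_s)^{k-q} ∘ (ad_{R_s})^q(L_x)`, where
`ad_{R_s}(T) = R_s ∘ T - T ∘ R_s`. -/
theorem left_mul_of_iterated_left_mul
    (F A : Type*) [Field F] [CharZero F]
    [NonUnitalNonAssocRing A] [Module F A] [SMulCommClass F A A] [IsScalarTower F A A]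
    (s : A) (hs : s ∈ Nalt A) (x : A) (k : ℕ) :
    LinearMap.mulLeft F (((LinearMap.mulLeft F s) ^ k) x) =
      ∑ q ∈ Finset.range (k + 1),
        (Nat.choose k q) •
          ((LinearMap.mulLeft F s) ^ (k - q) *
            ((fun T : Module.End F A =>
                LinearMap.mulRight F s * T - T * LinearMap.mulRight F s)^[q]
              (LinearMap.mulLeft F x))) := by
  set l : Module.End F A := LinearMap.mulLeft F s
  set r : Module.End F A := LinearMap.mulRight F s
  let lam : Module.End F (Module.End F A) := LinearMap.mulLeft F l
  let ad : Module.End F (Module.End F A) := LinearMap.mulLeft F r - LinearMap.mulRight F r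
  have hlr : l * r = r * l := commute_mulLeft_mulRight_of_mem_Nalt F hs
  have hcomm : Commute ad lam := by
    refine LinearMap.ext fun T => ?_
    change r * (l * T) - l * T * r = l * (r * T - T * r)
    rw [mul_sub, ← mul_assoc, ← mul_assoc, ← mul_assoc, hlr]
  have hpow : LinearMap.mulLeft F ((l ^ k) x) = ((ad + lam) ^ k) (LinearMap.mulLeft F x) := by
    induction k with
    | zero => simp
    | succ k ih =>
      rw [pow_succ', pow_succ', Module.End.mul_apply, Module.End.mul_apply, ← ih]
      exact mulLeft_mul_of_mem_Nalt F hs _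
  rw [hpow, hcomm.add_pow, LinearMap.sum_apply]
  refine Finset.sum_congr rfl fun q _ => ?_
  rw [(hcomm.pow_pow q (k - q)).eq, ← nsmul_eq_mul', LinearMap.smul_apply, Module.End.mul_apply,
    LinearMap.pow_mulLeft, LinearMap.mulLeft_apply, Module.End.pow_apply]
  rfl
end

section
/- Define polynomials X_i(κ,δ,ε) ∈ ℚ[w] (for integers i ≥ 0 and κ, δ, ε) by: X_0(0,0,0) = 1; X_i(κ,δ,ε) = 0 unless 0 ≤ κ ≤ i, 0 ≤ δ ≤ i−κ, 0 ≤ ε ≤ i−κ−δ; and the recursion X_{i+1}(κ,δ,ε) = (w + δ + ε)·X_i(κ,δ,ε) + X_i(κ−1,δ,ε) + X_i(κ,δ−1,ε) + X_i(κ,δ,ε−1). Then for all i ≥ 0 and all 0 ≤ κ ≤ i, 0 ≤ δ ≤ i−κ, 0 ≤ ε ≤ i−κ−δ: X_i(κ,δ,ε) = C(δ+ε, ε) · Σ_{ζ=0}^{i−κ−δ−ε} (i! / (κ! ζ! (i−κ−ζ)!)) · S(i−κ−ζ, δ+ε) · w^ζ, where S(r,s) = (1/s!) Σ_{t=0}^{s}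 (−1)^{s−t} C(s,t) t^r is the Stirling number of the second kind and C(·,·) denotes binomial coefficients. -/
open Polynomial

/-- Stirling numbers of the second kind,
`S(r,s) = (1/s!) Σ_{t=0}^{s} (-1)^{s-t} C(s,t) t^r` (with `0^0 = 1`). -/
noncomputable def stirling2 (r s : ℕ) : ℚ :=
  (1 / (s.factorial : ℚ)) *
    ∑ t ∈ Finset.range (s + 1), (-1 : ℚ) ^ (s - t) * (s.choose t : ℚ) * (t : ℚ) ^ r

/-- The polynomials `X_i(κ,δ,ε) ∈ ℚ[w]`: `X_0(0,0,0) = 1`, `X_0 = 0` elsewhere, and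
`X_{i+1}(κ,δ,ε) = (w+δ+ε)X_i(κ,δ,ε) + X_i(κ-1,δ,ε) + X_i(κ,δ-1,ε) + X_i(κ,δ,ε-1)`
(from which `X_i(κ,δ,ε) = 0` unless `0 ≤ κ ≤ i`, `0 ≤ δ ≤ i-κ`, `0 ≤ ε ≤ i-κ-δ`). -/
noncomputable def Xpoly : ℕ → ℤ → ℤ → ℤ → Polynomial ℚ
  | 0, κ, δ, ε => if κ = 0 ∧ δ = 0 ∧ ε = 0 then 1 else 0
  | i + 1, κ, δ, ε =>
      (Polynomial.X + Polynomial.C ((δ : ℚ) + (ε : ℚ))) * Xpoly i κ δ ε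
        + Xpoly i (κ - 1) δ ε + Xpoly i κ (δ - 1) ε + Xpoly i κ δ (ε - 1)

/-- The polynomial-valued extension `(1/s!) Σ_t (-1)^{s-t} C(s,t) (a+t)^r` of the Stirling numbers
of the second kind, which are recovered at `a = 0`. -/
noncomputable def shiftedStirling {A : Type*} [CommRing A] [Algebra ℚ A] (a : A) (r s : ℕ) : A :=
  (1 / (s.factorial : ℚ)) •
    ∑ t ∈ Finset.range (s + 1), ((-1 : ℚ) ^ (s - t) * (s.choose t : ℚ)) • (a + (t : A)) ^ r

section shiftedStirling

variable {A : Type*} [CommRing A] [Algebra ℚ A]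

theorem shiftedStirling_zero_right (a : A) (r : ℕ) : shiftedStirling a r 0 = a ^ r := by
  simp [shiftedStirling]

theorem shiftedStirling_zero_succ (a : A) (s : ℕ) : shiftedStirling a 0 (s + 1) = 0 := by
  have h := add_pow (1 : ℚ) (-1) (s + 1)
  simp only [add_neg_cancel, ne_eq, Nat.add_eq_zero_iff, one_ne_zero, and_false,
    not_false_eq_true, zero_pow, one_pow, one_mul] at h
  simp only [shiftedStirling, pow_zero, ← Finset.sum_smul, ← h, zero_smul, smul_zero]

theorem shiftedStirling_succ_succ (a : A) (r s : ℕ) :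
    shiftedStirling a (r + 1) (s + 1) =
      (a + ((s + 1 : ℕ) : A)) * shiftedStirling a r (s + 1) + shiftedStirling a r s := by
  have key : ∑ t ∈ Finset.range (s + 1),
        ((-1 : ℚ) ^ (s + 1 - t) * ((s + 1).choose t : ℚ)) • (a + (t : A)) ^ (r + 1) =
      (a + ((s + 1 : ℕ) : A)) * ∑ t ∈ Finset.range (s + 1),
        ((-1 : ℚ) ^ (s + 1 - t) * ((s + 1).choose t : ℚ)) • (a + (t : A)) ^ r +
      ((s : ℚ) + 1) • ∑ t ∈ Finset.range (s + 1),
        ((-1 : ℚ) ^ (s - t) * (s.choose t : ℚ)) • (a + (t : A)) ^ r := by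
    rw [Finset.mul_sum, Finset.smul_sum, ← Finset.sum_add_distrib]
    refine Finset.sum_congr rfl fun t ht => ?_
    obtain ⟨d, rfl⟩ := Nat.exists_eq_add_of_le (Nat.lt_succ_iff.mp (Finset.mem_range.mp ht))
    have hc : ((t + d + 1).choose t : ℚ) * (d + 1) = (t + d + 1) * ((t + d).choose t : ℚ) := by
      have := Nat.choose_mul_succ_eq (t + d) t
      rw [show t + d + 1 - t = d + 1 by omega] at this
      have h' : (((t + d).choose t * (t + d + 1) : ℕ) : ℚ) = _ := congrArg _ this
      push_cast at h'
      linarith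
    have hA := congrArg (algebraMap ℚ A) hc
    rw [show t + d + 1 - t = d + 1 by omega, show t + d - t = d by omega]
    simp only [Algebra.smul_def]
    push_cast [map_mul, map_add, map_pow, map_natCast, map_one, map_neg] at hA ⊢
    linear_combination (-1 : A) ^ (d + 1) * (a + t) ^ r * (-1) * hA
  have hf : (1 / ((s + 1).factorial : ℚ)) * ((s : ℚ) + 1) = 1 / (s.factorial : ℚ) := by
    rw [Nat.factorial_succ]
    push_cast
    field_simp
  simp only [shiftedStirling]
  rw [Finset.sum_range_succ _ (s + 1), Finset.sum_range_succ _ (s + 1), key, ← hf,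
    mul_smul (1 / ((s + 1).factorial : ℚ)) ((s : ℚ) + 1)]
  simp only [smul_add, mul_add (a + ((s + 1 : ℕ) : A)), mul_smul_comm, pow_succ' (a + _)]
  abel

theorem shiftedStirling_eq_zero_of_lt (r : ℕ) :
    ∀ s, r < s → shiftedStirling (0 : A) r s = 0 := by
  induction r with
  | zero =>
    rintro (_ | s) h
    · omega
    · exact shiftedStirling_zero_succ _ _
  | succ r ih =>
    rintro (_ | s) h
    · omega
    · rw [shiftedStirling_succ_succ, ih _ (by omega), ih _ (by omega), mul_zero, add_zero]

end shiftedStirling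

theorem stirling2_eq_shiftedStirling (r s : ℕ) : stirling2 r s = shiftedStirling (0 : ℚ) r s := by
  simp [stirling2, shiftedStirling]

theorem stirling2_eq_zero_of_lt {r s : ℕ} (h : r < s) : stirling2 r s = 0 := by
  rw [stirling2_eq_shiftedStirling, shiftedStirling_eq_zero_of_lt r s h]

theorem shiftedStirling_X_eq_sum (n s : ℕ) :
    shiftedStirling (X : ℚ[X]) n s =
      ∑ ζ ∈ Finset.range (n + 1), C ((n.choose ζ : ℚ) * stirling2 (n - ζ) s) * X ^ ζ := by
  simp only [shiftedStirling, stirling2, add_pow, Finset.smul_sum, Finset.mul_sum, map_sum,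
    Finset.sum_mul]
  rw [Finset.sum_comm]
  refine Finset.sum_congr rfl fun ζ _ => Finset.sum_congr rfl fun t _ => ?_
  simp only [smul_eq_C_mul, map_mul, map_pow, map_natCast]
  ring

theorem Xpoly_eq_zero_of_neg (i : ℕ) :
    ∀ κ δ ε : ℤ, κ < 0 ∨ δ < 0 ∨ ε < 0 → Xpoly i κ δ ε = 0 := by
  induction i with
  | zero =>
    intro κ δ ε h
    rw [Xpoly, if_neg (by omega)]
  | succ i ih =>
    intro κ δ ε h
    rw [Xpoly, ih _ _ _ h, ih (κ - 1) _ _ (by omega), ih _ (δ - 1) _ (by omega),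
      ih _ _ (ε - 1) (by omega)]
    simp

theorem choose_smul_shiftedStirling_succ (i κ s : ℕ) :
    ((i + 1).choose κ : ℚ) • shiftedStirling (X : ℚ[X]) (i + 1 - κ) s =
      (X + (s : ℚ[X])) * ((i.choose κ : ℚ) • shiftedStirling (X : ℚ[X]) (i - κ) s)
      + (if κ = 0 then 0 else
          (i.choose (κ - 1) : ℚ) • shiftedStirling (X : ℚ[X]) (i - (κ - 1)) s)
      + (if s = 0 then 0 else
          (i.choose κ : ℚ) • shiftedStirling (X : ℚ[X]) (i - κ) (s - 1)) := by
  have step (n : ℕ) : shiftedStirling (X : ℚ[X]) (n + 1) s =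
      (X + (s : ℚ[X])) * shiftedStirling X n s
        + (if s = 0 then 0 else shiftedStirling X n (s - 1)) := by
    rcases s with _ | s
    · simp [shiftedStirling_zero_right, pow_succ']
    · simp [shiftedStirling_succ_succ]
  rcases κ with _ | k
  · have := step i
    split_ifs at this ⊢ <;> simp_all
  · rcases lt_or_ge i (k + 1) with h | h
    · simp [Nat.choose_eq_zero_of_lt h, Nat.choose_succ_succ]
    · obtain ⟨m, rfl⟩ := Nat.exists_eq_add_of_le h
      have := step m
      rw [show k + 1 + m + 1 - (k + 1) = m + 1 by omega, show k + 1 + m - (k + 1) = m by omega,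
        show k + 1 + m - (k + 1 - 1) = m + 1 by omega, Nat.choose_succ_succ (k + 1 + m) k]
      simp only [Nat.add_sub_cancel, Nat.cast_add, add_smul, if_neg (Nat.succ_ne_zero k)]
      rw [show ((k + 1 + m).choose k.succ : ℚ) • shiftedStirling (X : ℚ[X]) (m + 1) s = _ from
        congrArg _ this]
      split_ifs <;> simp only [smul_add, mul_smul_comm, smul_zero] <;> abel

theorem Xpoly_eq_smul_shiftedStirling (i : ℕ) : ∀ κ δ ε : ℕ,
    Xpoly i (κ : ℤ) (δ : ℤ) (ε : ℤ) =
      ((δ + ε).choose ε : ℚ) •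
        (i.choose κ : ℚ) • shiftedStirling (X : ℚ[X]) (i - κ) (δ + ε) := by
  induction i with
  | zero =>
    intro κ δ ε
    rcases κ with _ | κ
    · rcases h : δ + ε with _ | s
      · obtain ⟨rfl, rfl⟩ : δ = 0 ∧ ε = 0 := by omega
        simp [Xpoly, shiftedStirling_zero_right]
      · rw [Xpoly, if_neg (by omega), Nat.zero_sub, shiftedStirling_zero_succ]
        simp
    · rw [Xpoly, if_neg (by omega)]
      simp
  | succ i ih =>
    intro κ δ ε
    have hκ : Xpoly i ((κ : ℤ) - 1) δ ε = ((δ + ε).choose ε : ℚ) • (if κ = 0 then 0 else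
        (i.choose (κ - 1) : ℚ) • shiftedStirling (X : ℚ[X]) (i - (κ - 1)) (δ + ε)) := by
      rcases κ with _ | κ
      · rw [Xpoly_eq_zero_of_neg _ _ _ _ (by omega)]
        simp
      · simpa using ih κ δ ε
    have hδε : Xpoly i κ ((δ : ℤ) - 1) ε + Xpoly i κ δ ((ε : ℤ) - 1) =
        ((δ + ε).choose ε : ℚ) • (if δ + ε = 0 then 0 else
          (i.choose κ : ℚ) • shiftedStirling (X : ℚ[X]) (i - κ) (δ + ε - 1)) := by
      rcases δ with _ | δ <;> rcases ε with _ | ε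
      · rw [Xpoly_eq_zero_of_neg _ _ _ _ (by omega), Xpoly_eq_zero_of_neg _ _ _ _ (by omega)]
        simp
      · rw [Xpoly_eq_zero_of_neg _ _ _ _ (by omega)]
        simpa using ih κ 0 ε
      · rw [Xpoly_eq_zero_of_neg _ _ _ ((0 : ℕ) - 1 : ℤ) (by omega)]
        simpa using ih κ δ 0
      · have h₁ := ih κ δ (ε + 1)
        have h₂ := ih κ (δ + 1) ε
        rw [show δ + 1 + ε = δ + (ε + 1) by omega] at h₂
        rw [show ((δ + 1 : ℕ) : ℤ) - 1 = (δ : ℕ) by push_cast; ring,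
          show ((ε + 1 : ℕ) : ℤ) - 1 = (ε : ℕ) by push_cast; ring, h₁, h₂, ← add_smul,
          if_neg (by omega), show δ + 1 + (ε + 1) - 1 = δ + (ε + 1) by omega,
          show δ + 1 + (ε + 1) = δ + (ε + 1) + 1 by omega, Nat.choose_succ_succ, Nat.cast_add,
          add_comm (((δ + (ε + 1)).choose (ε + 1) : ℕ) : ℚ)]
    rw [Xpoly, add_assoc, hδε, hκ, ih, choose_smul_shiftedStirling_succ, smul_add, smul_add,
      mul_smul_comm]
    simp

/-- closed formula for `X_i(κ,δ,ε)` in terms of Stirling numbers of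
the second kind:
`X_i(κ,δ,ε) = C(δ+ε,ε) Σ_{ζ=0}^{i-κ-δ-ε} (i!/(κ! ζ! (i-κ-ζ)!)) S(i-κ-ζ, δ+ε) w^ζ`. -/
theorem Xpoly_closed_formula
    (i κ δ ε : ℕ) (hκ : κ ≤ i) (hδ : δ ≤ i - κ) (hε : ε ≤ i - κ - δ) :
    Xpoly i (κ : ℤ) (δ : ℤ) (ε : ℤ) =
      ((δ + ε).choose ε : ℚ) •
        ∑ ζ ∈ Finset.range (i - κ - δ - ε + 1),
          Polynomial.C
              ((i.factorial : ℚ) /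
                  ((κ.factorial : ℚ) * (ζ.factorial : ℚ) * ((i - κ - ζ).factorial : ℚ)) *
                stirling2 (i - κ - ζ) (δ + ε)) *
            Polynomial.X ^ ζ := by
  rw [Xpoly_eq_smul_shiftedStirling, shiftedStirling_X_eq_sum, Finset.smul_sum]
  congr 1
  symm
  refine Finset.sum_subset_zero_on_sdiff (Finset.range_mono (by omega)) (fun ζ hζ => ?_)
    fun ζ hζ => ?_
  · rw [Finset.mem_sdiff, Finset.mem_range, Finset.mem_range] at hζ
    rw [stirling2_eq_zero_of_lt (by omega)]
    simp
  · rw [Finset.mem_range] at hζ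
    rw [smul_eq_C_mul, ← mul_assoc, ← map_mul, ← mul_assoc, Nat.cast_choose ℚ hκ,
      Nat.cast_choose ℚ (show ζ ≤ i - κ by omega)]
    congr 3
    field_simp
end

section
/- Let F be a field of characteristic 0 and let P = F[a,b,c,d,e] be the polynomial algebra in five variables. On P, let M_x denote multiplication by the variable x, D_x the formal partial derivative with respect to x, I the identity, and S^α (for α ∈ F) the F-algebra endomorphism substituting a ↦ a + α (so S = S^1, S^{−1} = shift by −1). Define the operators L_b = S M_b + (S^{−1} − S) D_c M_d and L_c = S M_c − (S + S^{−1}) D_b M_d. Then for all u, x ≥ 0: L_b^u = Σ_{η=0}^{u} Σ_{θ=0}^{u−η} (−1)^{u−η−θ} (u! / (η! θ! (u−η−θ)!)) S^{u−2θ} M_b^{η} M_d^{u−η} D_c^{u−η}, and L_c^x = Σ_{λ=0}^{x} Σ_{μ=0}^{x−λ} (−1)^{x−λ} (x! / (λ! μ! (x−λ−μ)!)) S^{x−2μ} M_c^{λ} M_d^{x−λ} D_b^{x−λ}. -/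
open MvPolynomial

/-- Multiplication by the `i`-th variable on `P = F[a,b,c,d,e]`
(variables indexed `a=0, b=1, c=2, d=3, e=4`). -/
noncomputable def Mop (F : Type*) [Field F] (i : Fin 5) :
    Module.End F (MvPolynomial (Fin 5) F) :=
  LinearMap.mulLeft F (MvPolynomial.X i)

/-- Formal partial derivative with respect to the `i`-th variable. -/
noncomputable def Dvop (F : Type*) [Field F] (i : Fin 5) :
    Module.End F (MvPolynomial (Fin 5) F) :=
  (MvPolynomial.pderiv i).toLinearMap

/-- The shift operator `S^α`: the `F`-algebra endomorphism of `F[a,b,c,d,e]`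
substituting `a ↦ a + α` and fixing the other variables. -/
noncomputable def Sop (F : Type*) [Field F] (α : F) :
    Module.End F (MvPolynomial (Fin 5) F) :=
  (MvPolynomial.aeval fun j : Fin 5 =>
    if j = 0 then MvPolynomial.X 0 + MvPolynomial.C α else MvPolynomial.X j).toLinearMap

/-- Trinomial expansion of `(σ 1 * m + (δ σ (-1) + ε σ 1) * D * w) ^ n` for a one-parameter family
`σ` and elements `m`, `D`, `w`, all commuting with one another. -/
theorem shift_trinomial_pow {F A : Type*} [Field F] [CharZero F] [Ring A] [Algebra F A]
    (σ : F → A) (hσ0 : σ 0 = 1) (hσ : ∀ α β, σ (α + β) = σ α * σ β) (m D w : A)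
    (hσm : ∀ α, Commute (σ α) m) (hσD : ∀ α, Commute (σ α) D) (hσw : ∀ α, Commute (σ α) w)
    (hmD : Commute m D) (hmw : Commute m w) (hDw : Commute D w) (δ ε : F) (n : ℕ) :
    (σ 1 * m + (δ • σ (-1) + ε • σ 1) * D * w) ^ n =
      ∑ i ∈ Finset.range (n + 1), ∑ j ∈ Finset.range (n - i + 1),
        (δ ^ j * ε ^ (n - i - j) *
            ((n.factorial : F) /
              ((i.factorial : F) * (j.factorial : F) * ((n - i - j).factorial : F)))) •
          (σ ((n : F) - 2 * (j : F)) * m ^ i * w ^ (n - i) * D ^ (n - i)) := by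
  have hσσ : ∀ α β, Commute (σ α) (σ β) := fun α β => by
    rw [Commute, SemiconjBy, ← hσ, ← hσ, add_comm]
  have hpow : ∀ (α : F) (k : ℕ), σ α ^ k = σ (k * α) := by
    intro α k
    induction k with
    | zero => simp [hσ0]
    | succ k ih => rw [pow_succ, ih, ← hσ]; congr 1; push_cast; ring
  have hT (β : F) : Commute (σ β) (δ • σ (-1) + ε • σ 1) :=
    ((hσσ β (-1)).smul_right δ).add_right ((hσσ β 1).smul_right ε)
  have hmT : Commute m (δ • σ (-1) + ε • σ 1) :=
    ((hσm (-1)).symm.smul_right δ).add_right ((hσm 1).symm.smul_right ε)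
  have hTw : Commute (δ • σ (-1) + ε • σ 1) w :=
    ((hσw (-1)).smul_left δ).add_left ((hσw 1).smul_left ε)
  have hTD : Commute (δ • σ (-1) + ε • σ 1) D :=
    ((hσD (-1)).smul_left δ).add_left ((hσD 1).smul_left ε)
  have hcomm : Commute (σ 1 * m) ((δ • σ (-1) + ε • σ 1) * D * w) :=
    (((hT 1).mul_right (hσD 1)).mul_right (hσw 1)).mul_left ((hmT.mul_right hmD).mul_right hmw)
  rw [hcomm.add_pow]
  refine Finset.sum_congr rfl fun i hi => ?_
  have hin : i ≤ n := Nat.lt_succ_iff.mp (Finset.mem_range.mp hi)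
  rw [(hTw.mul_left hDw).mul_pow, hTD.mul_pow, (hσm 1).mul_pow,
    (((hσσ (-1) 1).smul_left δ).smul_right ε).add_pow]
  simp only [Finset.sum_mul, Finset.mul_sum]
  refine Finset.sum_congr rfl fun j hj => ?_
  have hjn : j ≤ n - i := Nat.lt_succ_iff.mp (Finset.mem_range.mp hj)
  have hshift : σ 1 ^ i * (σ (-1) ^ j * σ 1 ^ (n - i - j)) = σ ((n : F) - 2 * (j : F)) := by
    rw [hpow, hpow, hpow, ← hσ, ← hσ]
    congr 1
    rw [Nat.cast_sub hjn, Nat.cast_sub hin]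
    ring
  have hcoef : ((n.choose i : F) * ((n - i).choose j : F)) =
      (n.factorial : F) /
        ((i.factorial : F) * (j.factorial : F) * ((n - i - j).factorial : F)) := by
    rw [Nat.cast_choose F hin, Nat.cast_choose F hjn]
    have := Nat.cast_ne_zero (R := F).mpr (n - i).factorial_ne_zero
    field_simp
  have hmid : Commute (m ^ i) (σ (-1) ^ j * σ 1 ^ (n - i - j)) :=
    ((hσm (-1)).symm.pow_pow i j).mul_right ((hσm 1).symm.pow_pow i _)
  rw [← hshift, ← hcoef, smul_pow, smul_pow, ← nsmul_eq_mul', ← nsmul_eq_mul',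
    ← Nat.cast_smul_eq_nsmul F, ← Nat.cast_smul_eq_nsmul F]
  simp only [smul_mul_assoc, mul_smul_comm, smul_smul]
  congr 1
  · ring
  · rw [mul_assoc _ (w ^ _), ← (hDw.pow_pow (n - i) (n - i)).eq, mul_assoc (σ 1 ^ i) _ (m ^ i),
      ← hmid.eq]
    simp only [mul_assoc]

theorem sub_add_mul_mul_eq {F A : Type*} [Field F] [Ring A] [Algebra F A] (y s t D w : A) :
    y - (s + t) * D * w = y + ((-1 : F) • t + (-1 : F) • s) * D * w := by
  rw [neg_one_smul, neg_one_smul, ← neg_add, neg_mul, neg_mul, ← sub_eq_add_neg, add_comm s]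

section Operators

variable (F : Type*) [Field F]

theorem Sop_zero : Sop F 0 = 1 := by
  have h : (fun j : Fin 5 => if j = 0 then X 0 + C 0 else X j) =
      (X : Fin 5 → MvPolynomial (Fin 5) F) := by
    funext j
    split_ifs with hj <;> simp [hj]
  refine LinearMap.ext fun p => ?_
  simp only [Sop, h]
  simp

theorem Sop_add (α β : F) : Sop F (α + β) = Sop F α * Sop F β := by
  refine LinearMap.ext fun p => ?_
  simp only [Sop, Module.End.mul_apply, AlgHom.toLinearMap_apply]
  rw [← AlgHom.comp_apply]
  congr 1
  refine MvPolynomial.algHom_ext fun j => ?_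
  by_cases hj : j = 0
  · simp [hj, algebraMap_eq, add_assoc]
  · simp [hj]

theorem commute_Sop_Mop (α : F) {i : Fin 5} (hi : i ≠ 0) : Commute (Sop F α) (Mop F i) := by
  refine LinearMap.ext fun p => ?_
  simp [Sop, Mop, hi]

theorem commute_Sop_Dvop (α : F) {i : Fin 5} (hi : i ≠ 0) : Commute (Sop F α) (Dvop F i) := by
  refine LinearMap.ext fun p => ?_
  simp only [Sop, Dvop, Module.End.mul_apply, AlgHom.toLinearMap_apply]
  change bind₁ _ (pderiv i p) = pderiv i (bind₁ _ p)
  induction p using MvPolynomial.induction_on with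
  | C r => simp [algebraMap_eq]
  | add p q hp hq => simp [hp, hq]
  | mul_X p j hp =>
    by_cases hj : j = 0
    · subst hj
      simp [Derivation.leibniz, hp, pderiv_X_of_ne hi.symm]
    · by_cases hij : j = i
      · subst hij
        simp [Derivation.leibniz, hp, hj]
      · simp [Derivation.leibniz, hp, hj, pderiv_X_of_ne hij]

theorem commute_Mop_Mop (i j : Fin 5) : Commute (Mop F i) (Mop F j) :=
  LinearMap.ext fun p => by simp [Mop, mul_left_comm]

theorem commute_Mop_Dvop {i j : Fin 5} (hij : i ≠ j) : Commute (Mop F i) (Dvop F j) :=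
  LinearMap.ext fun p => by simp [Mop, Dvop, Derivation.leibniz, pderiv_X_of_ne hij]

end Operators

/-- closed formulas for the powers of the operators
`L_b = S M_b + (S⁻¹ - S) D_c M_d` and `L_c = S M_c - (S + S⁻¹) D_b M_d`
on the polynomial algebra `F[a,b,c,d,e]`. -/
theorem powers_of_Lb_and_Lc (F : Type*) [Field F] [CharZero F] :
    (∀ u : ℕ,
      (Sop F 1 * Mop F 1 + (Sop F (-1) - Sop F 1) * Dvop F 2 * Mop F 3) ^ u =
        ∑ η ∈ Finset.range (u + 1), ∑ θ ∈ Finset.range (u - η + 1),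
          ((-1 : F) ^ (u - η - θ) *
              ((u.factorial : F) /
                ((η.factorial : F) * (θ.factorial : F) * ((u - η - θ).factorial : F)))) •
            (Sop F ((u : F) - 2 * (θ : F)) * (Mop F 1) ^ η * (Mop F 3) ^ (u - η) *
              (Dvop F 2) ^ (u - η))) ∧
    (∀ x : ℕ,
      (Sop F 1 * Mop F 2 - (Sop F 1 + Sop F (-1)) * Dvop F 1 * Mop F 3) ^ x =
        ∑ lam ∈ Finset.range (x + 1), ∑ μ ∈ Finset.range (x - lam + 1),
          ((-1 : F) ^ (x - lam) *
              ((x.factorial : F) /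
                ((lam.factorial : F) * (μ.factorial : F) * ((x - lam - μ).factorial : F)))) •
            (Sop F ((x : F) - 2 * (μ : F)) * (Mop F 2) ^ lam * (Mop F 3) ^ (x - lam) *
              (Dvop F 1) ^ (x - lam))) := by
  have key (i j : Fin 5) (hi : i ≠ 0) (hj : j ≠ 0) (hij : i ≠ j) (hj3 : 3 ≠ j) :=
    shift_trinomial_pow (Sop F) (Sop_zero F) (Sop_add F) (Mop F i) (Dvop F j) (Mop F 3)
      (fun α => commute_Sop_Mop F α hi) (fun α => commute_Sop_Dvop F α hj)
      (fun α => commute_Sop_Mop F α (by decide)) (commute_Mop_Dvop F hij)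
      (commute_Mop_Mop F i 3) (commute_Mop_Dvop F hj3).symm
  refine ⟨fun u => ?_, fun x => ?_⟩
  · have h := key 1 2 (by decide) (by decide) (by decide) (by decide) 1 (-1) u
    simpa only [one_smul, neg_smul, ← sub_eq_add_neg, one_pow, one_mul] using h
  · have h := key 2 1 (by decide) (by decide) (by decide) (by decide) (-1) (-1) x
    refine (congrArg (· ^ x) (sub_add_mul_mul_eq (F := F) _ _ _ _ _)).trans (h.trans ?_)
    refine Finset.sum_congr rfl fun i _ => Finset.sum_congr rfl fun j hj => ?_
    rw [← pow_add, Nat.add_sub_cancel' (Nat.lt_succ_iff.mp (Finset.mem_range.mp hj))]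
end

section
/- Let F be a field of characteristic 0, γ ∈ F with γ ≠ 0, and P = F[a,b,c,d,e] the polynomial algebra in five variables. Define the F-linear operators on P: ρ_a = M_b D_b + M_c D_c − M_d D_d + γ M_e D_e − 3 D_b D_c M_d; ρ_b = (I − S) M_b + (S − 2S^{−1} − I) D_c M_d; ρ_c = (I − S) M_c + (S + 2S^{−1} − I) D_b M_d; ρ_d = (I − S^{−1}) M_d; ρ_e = (I − S^{−γ}) M_e. Let Z = { f ∈ P : ρ_a f = ρ_b f = ρ_c f = ρ_d f = ρ_e f = 0 }. Then: (i) if γ = l/m where l and m are coprime positive integers, Z is the F-linear span of { (d^l e^m)^n : n ≥ 0 }, i.e. the polynomial subalgebra F[d^l e^m]; and (ii) if there exist no positive integers l, m with mγ = l in F, then Z = F·1. -/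
open MvPolynomial

/-- `ρ_a = M_b D_b + M_c D_c - M_d D_d + γ M_e D_e - 3 D_b D_c M_d`. -/
noncomputable def rhoA (F : Type*) [Field F] (γ : F) :
    Module.End F (MvPolynomial (Fin 5) F) :=
  Mop F 1 * Dvop F 1 + Mop F 2 * Dvop F 2 - Mop F 3 * Dvop F 3
    + γ • (Mop F 4 * Dvop F 4) - (3 : F) • (Dvop F 1 * Dvop F 2 * Mop F 3)

/-- `ρ_b = (I - S) M_b + (S - 2S⁻¹ - I) D_c M_d`. -/
noncomputable def rhoB (F : Type*) [Field F] :
    Module.End F (MvPolynomial (Fin 5) F) :=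
  (1 - Sop F 1) * Mop F 1 + (Sop F 1 - (2 : F) • Sop F (-1) - 1) * Dvop F 2 * Mop F 3

/-- `ρ_c = (I - S) M_c + (S + 2S⁻¹ - I) D_b M_d`. -/
noncomputable def rhoC (F : Type*) [Field F] :
    Module.End F (MvPolynomial (Fin 5) F) :=
  (1 - Sop F 1) * Mop F 2 + (Sop F 1 + (2 : F) • Sop F (-1) - 1) * Dvop F 1 * Mop F 3

/-- `ρ_d = (I - S⁻¹) M_d`. -/
noncomputable def rhoD (F : Type*) [Field F] :
    Module.End F (MvPolynomial (Fin 5) F) :=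
  (1 - Sop F (-1)) * Mop F 3

/-- `ρ_e = (I - S^{-γ}) M_e`. -/
noncomputable def rhoE (F : Type*) [Field F] (γ : F) :
    Module.End F (MvPolynomial (Fin 5) F) :=
  (1 - Sop F (-γ)) * Mop F 4

/-- `Z = { f ∈ P : ρ_a f = ρ_b f = ρ_c f = ρ_d f = ρ_e f = 0 }`. -/
def Zcenter (F : Type*) [Field F] (γ : F) : Set (MvPolynomial (Fin 5) F) :=
  {f | rhoA F γ f = 0 ∧ rhoB F f = 0 ∧ rhoC F f = 0 ∧ rhoD F f = 0 ∧ rhoE F γ f = 0}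

section ShiftInvariance

/-- A polynomial over a domain of characteristic zero that is invariant under a nonzero
translation of its variable is constant. -/
theorem Polynomial.eq_C_of_comp_X_add_C_eq {R : Type*} [CommRing R] [IsDomain R] [CharZero R]
    {p : Polynomial R} {r : R} (hr : r ≠ 0)
    (h : p.comp (Polynomial.X + Polynomial.C r) = p) : p = Polynomial.C (p.eval 0) := by
  have key : ∀ n : ℕ, p.eval ((n : R) * r) = p.eval 0 := by
    intro n
    induction n with
    | zero => simp
    | succ n ih =>
      rw [← ih]
      conv_rhs => rw [← h]
      simp [Polynomial.eval_comp, add_mul]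
  apply Polynomial.eq_of_infinite_eval_eq
  refine (Set.infinite_range_of_injective (f := fun n : ℕ => (n : R) * r) ?_).mono ?_
  · intro m n hmn
    exact_mod_cast mul_right_cancel₀ hr hmn
  · rintro _ ⟨n, rfl⟩
    simp [key n]

variable {F : Type*} [Field F]

theorem finSuccEquiv_Sop (α : F) (f : MvPolynomial (Fin 5) F) :
    finSuccEquiv F 4 (Sop F α f) =
      (finSuccEquiv F 4 f).comp (Polynomial.X + Polynomial.C (C α)) := by
  induction f using MvPolynomial.induction_on with
  | C r => simp [Sop, finSuccEquiv_apply]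
  | add p q hp hq => simp [hp, hq]
  | mul_X p i hp =>
    have hX : finSuccEquiv F 4 (Sop F α (X i)) =
        (finSuccEquiv F 4 (X i)).comp (Polynomial.X + Polynomial.C (C α)) := by
      refine Fin.cases ?_ (fun j => ?_) i
      · simp [Sop, finSuccEquiv_apply]
      · simp [Sop, finSuccEquiv_apply]
    have hm : Sop F α (p * X i) = Sop F α p * Sop F α (X i) := by simp [Sop]
    rw [hm, map_mul, map_mul, hp, hX, Polynomial.mul_comp]

theorem zero_notMem_vars_of_Sop_eq [CharZero F] {α : F} (hα : α ≠ 0)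
    {f : MvPolynomial (Fin 5) F} (h : Sop F α f = f) : 0 ∉ f.vars := by
  have hp := Polynomial.eq_C_of_comp_X_add_C_eq (p := finSuccEquiv F 4 f) (r := C α)
    (by simpa using hα) (by rw [← finSuccEquiv_Sop, h])
  rw [mem_vars_iff_mem_support]
  rintro ⟨m, hm, h0⟩
  rw [mem_support_iff, ← Finsupp.cons_tail m, ← finSuccEquiv_coeff_coeff, hp,
    Polynomial.coeff_C_of_ne_zero (Finsupp.mem_support_iff.mp h0)] at hm
  simp at hm

theorem Sop_eq_self (α : F) {f : MvPolynomial (Fin 5) F} (h : 0 ∉ f.vars) :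
    Sop F α f = f := by
  change aeval _ f = f
  conv_rhs => rw [← aeval_X_left_apply f]
  refine eval₂Hom_congr' rfl (fun i hi _ => ?_) rfl
  have : i ≠ 0 := fun hi0 => h (hi0 ▸ hi)
  simp [this]

theorem Sop_mul (α : F) (f g : MvPolynomial (Fin 5) F) :
    Sop F α (f * g) = Sop F α f * Sop F α g := by
  simp [Sop]

theorem Sop_X_of_ne_zero (α : F) {i : Fin 5} (hi : i ≠ 0) : Sop F α (X i) = X i := by
  simp [Sop, hi]

end ShiftInvariance

section Derivations

variable {σ R : Type*} [CommRing R]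

theorem notMem_vars_of_pderiv_eq_zero [IsDomain R] [CharZero R] {i : σ} {f : MvPolynomial σ R}
    (h : pderiv i f = 0) : i ∉ f.vars := by
  classical
  rw [mem_vars_iff_mem_support]
  rintro ⟨m, hm, hi⟩
  have hle : Finsupp.single i 1 ≤ m := by
    simpa [Nat.one_le_iff_ne_zero] using hi
  have hc := coeff_pderiv (i := i) f (m - Finsupp.single i 1)
  rw [h, tsub_add_cancel_of_le hle, coeff_zero] at hc
  rcases mul_eq_zero.mp hc.symm with h0 | h0
  · exact mem_support_iff.mp hm h0
  · exact Nat.cast_add_one_ne_zero _ h0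

theorem vars_pderiv_subset (i : σ) (f : MvPolynomial σ R) : (pderiv i f).vars ⊆ f.vars := by
  intro j hj
  rw [mem_vars_iff_mem_support] at hj ⊢
  obtain ⟨m, hm, hjm⟩ := hj
  rw [mem_support_iff, coeff_pderiv] at hm
  refine ⟨m + Finsupp.single i 1, mem_support_iff.mpr (left_ne_zero_of_mul hm), ?_⟩
  rw [Finsupp.mem_support_iff] at hjm ⊢
  simp [hjm]

theorem coeff_X_mul_pderiv (i : σ) (f : MvPolynomial σ R) (m : σ →₀ ℕ) :
    coeff m (X i * pderiv i f) = m i * coeff m f := by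
  classical
  rw [coeff_X_mul']
  split_ifs with hi
  · have hle : Finsupp.single i 1 ≤ m := by
      simpa [Nat.one_le_iff_ne_zero] using hi
    have hcast : (((m - Finsupp.single i 1 : σ →₀ ℕ) i : ℕ) : R) + 1 = m i := by
      rw [← Nat.cast_add_one]
      congr 1
      simpa using Nat.sub_add_cancel (Nat.one_le_iff_ne_zero.mpr (Finsupp.mem_support_iff.mp hi))
    rw [coeff_pderiv, tsub_add_cancel_of_le hle, hcast, mul_comm]
  · simp [Finsupp.notMem_support_iff.mp hi]

end Derivations

section Center

variable {F : Type*} [Field F] [CharZero F]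

theorem mem_Zcenter_iff_vars (γ : F) (f : MvPolynomial (Fin 5) F) :
    f ∈ Zcenter F γ ↔ 0 ∉ f.vars ∧ 1 ∉ f.vars ∧ 2 ∉ f.vars ∧
      X 3 * pderiv 3 f = γ • (X 4 * pderiv 4 f) := by
  have hX (α : F) {i : Fin 5} (hi : i ≠ 0) (h0 : 0 ∉ f.vars) :
      Sop F α (X i * f) = X i * f := by
    rw [Sop_mul, Sop_X_of_ne_zero α hi, Sop_eq_self α h0]
  have hD (α : F) {i : Fin 5} (hi : i ≠ 3) (h0 : 0 ∉ f.vars) :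
      Sop F α (pderiv i (X 3 * f)) = X 3 * pderiv i f := by
    have h0' : 0 ∉ (pderiv i f).vars := fun h => h0 (vars_pderiv_subset i f h)
    rw [pderiv_mul, pderiv_X_of_ne hi.symm, zero_mul, zero_add, Sop_mul,
      Sop_X_of_ne_zero α (by decide), Sop_eq_self α h0']
  have hd {i : Fin 5} (hi : i ≠ 3) : pderiv i (X 3 * f) = X 3 * pderiv i f := by
    rw [pderiv_mul, pderiv_X_of_ne hi.symm, zero_mul, zero_add]
  constructor
  · rintro ⟨ha, hb, hc, hd', -⟩
    have h0 : 0 ∉ f.vars := by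
      apply zero_notMem_vars_of_Sop_eq (α := (-1 : F)) (by simp)
      change X 3 * f - Sop F (-1) (X 3 * f) = 0 at hd'
      rw [Sop_mul, Sop_X_of_ne_zero _ (by decide), sub_eq_zero] at hd'
      exact (mul_left_cancel₀ (X_ne_zero _) hd').symm
    have h2 : pderiv 2 f = 0 := by
      change (X 1 * f - Sop F 1 (X 1 * f)) +
        (Sop F 1 (pderiv 2 (X 3 * f)) - (2 : F) • Sop F (-1) (pderiv 2 (X 3 * f))
          - pderiv 2 (X 3 * f)) = 0 at hb
      rw [hX _ (by decide) h0, hD _ (by decide) h0, hD _ (by decide) h0, hd (by decide)] at hb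
      simpa using hb
    have h1 : pderiv 1 f = 0 := by
      change (X 2 * f - Sop F 1 (X 2 * f)) +
        (Sop F 1 (pderiv 1 (X 3 * f)) + (2 : F) • Sop F (-1) (pderiv 1 (X 3 * f))
          - pderiv 1 (X 3 * f)) = 0 at hc
      rw [hX _ (by decide) h0, hD _ (by decide) h0, hD _ (by decide) h0, hd (by decide)] at hc
      simpa using hc
    refine ⟨h0, notMem_vars_of_pderiv_eq_zero h1, notMem_vars_of_pderiv_eq_zero h2, ?_⟩
    change X 1 * pderiv 1 f + X 2 * pderiv 2 f - X 3 * pderiv 3 f + γ • (X 4 * pderiv 4 f)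
      - (3 : F) • pderiv 1 (pderiv 2 (X 3 * f)) = 0 at ha
    rw [hd (by decide), h1, h2] at ha
    simp only [mul_zero, map_zero, smul_zero, add_zero, sub_zero, zero_sub] at ha
    exact (neg_add_eq_zero.mp ha)
  · rintro ⟨h0, h1, h2, h⟩
    have h1' := pderiv_eq_zero_of_notMem_vars h1
    have h2' := pderiv_eq_zero_of_notMem_vars h2
    refine ⟨?_, ?_, ?_, ?_, ?_⟩
    · change X 1 * pderiv 1 f + X 2 * pderiv 2 f - X 3 * pderiv 3 f + γ • (X 4 * pderiv 4 f)
        - (3 : F) • pderiv 1 (pderiv 2 (X 3 * f)) = 0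
      rw [hd (by decide), h1', h2', h]
      simp
    · change (X 1 * f - Sop F 1 (X 1 * f)) +
        (Sop F 1 (pderiv 2 (X 3 * f)) - (2 : F) • Sop F (-1) (pderiv 2 (X 3 * f))
          - pderiv 2 (X 3 * f)) = 0
      rw [hX _ (by decide) h0, hd (by decide), h2']
      simp
    · change (X 2 * f - Sop F 1 (X 2 * f)) +
        (Sop F 1 (pderiv 1 (X 3 * f)) + (2 : F) • Sop F (-1) (pderiv 1 (X 3 * f))
          - pderiv 1 (X 3 * f)) = 0
      rw [hX _ (by decide) h0, hd (by decide), h1']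
      simp
    · change X 3 * f - Sop F (-1) (X 3 * f) = 0
      rw [hX _ (by decide) h0, sub_self]
    · change X 4 * f - Sop F (-γ) (X 4 * f) = 0
      rw [hX _ (by decide) h0, sub_self]

/-- The center is spanned by the monomials `d^i e^j` with `i = γ j`. -/
theorem Zcenter_eq_restrictSupport (γ : F) :
    Zcenter F γ = restrictSupport F
      {m : Fin 5 →₀ ℕ | m 0 = 0 ∧ m 1 = 0 ∧ m 2 = 0 ∧ (m 3 : F) = γ * m 4} := by
  have hvars (i : Fin 5) (f : MvPolynomial (Fin 5) F) :
      i ∉ f.vars ↔ ∀ m ∈ f.support, m i = 0 := by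
    rw [mem_vars_iff_mem_support]
    push Not
    simp only [Finsupp.notMem_support_iff]
  ext f
  rw [mem_Zcenter_iff_vars, hvars, hvars, hvars, SetLike.mem_coe, mem_restrictSupport_iff,
    MvPolynomial.ext_iff]
  simp only [coeff_smul, coeff_X_mul_pderiv, smul_eq_mul, ← mul_assoc]
  constructor
  · rintro ⟨h0, h1, h2, h⟩ m hm
    exact ⟨h0 m hm, h1 m hm, h2 m hm, mul_right_cancel₀ (mem_support_iff.mp hm) (h m)⟩
  · intro h
    refine ⟨fun m hm => (h hm).1, fun m hm => (h hm).2.1, fun m hm => (h hm).2.2.1, fun m => ?_⟩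
    by_cases hm : m ∈ f.support
    · rw [(h hm).2.2.2]
    · rw [notMem_support_iff.mp hm, mul_zero, mul_zero]

end Center

/-- the common kernel `Z` of the adjoint operators
`ρ_a, ρ_b, ρ_c, ρ_d, ρ_e` (the center of `U(M_γ)`) is `F[d^l e^m]` when
`γ = l/m` with `l, m` coprime positive integers, and is `F·1` when no positive
integers `l, m` satisfy `mγ = l` in `F`. -/
theorem center_of_enveloping_algebra
    (F : Type*) [Field F] [CharZero F] (γ : F) (hγ : γ ≠ 0) :
    (∀ l m : ℕ, 0 < l → 0 < m → Nat.Coprime l m → γ = (l : F) / (m : F) →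
      Zcenter F γ =
        ↑(Submodule.span F
            (Set.range fun n : ℕ =>
              (MvPolynomial.X 3 ^ l * MvPolynomial.X 4 ^ m : MvPolynomial (Fin 5) F) ^ n))) ∧
    ((¬ ∃ l m : ℕ, 0 < l ∧ 0 < m ∧ (m : F) * γ = (l : F)) →
      Zcenter F γ =
        ↑(Submodule.span F ({1} : Set (MvPolynomial (Fin 5) F)))) := by
  rw [Zcenter_eq_restrictSupport, restrictSupport_eq_span]
  constructor
  · intro l m hl hm hlm hγ'
    have hm' : (m : F) ≠ 0 := Nat.cast_ne_zero.mpr hm.ne'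
    have hpow (n : ℕ) : (X 3 ^ l * X 4 ^ m : MvPolynomial (Fin 5) F) ^ n =
        monomial (Finsupp.single 3 (l * n) + Finsupp.single 4 (m * n)) 1 := by
      rw [mul_pow, ← pow_mul, ← pow_mul, X_pow_eq_monomial, X_pow_eq_monomial, monomial_mul,
        one_mul]
    congr 2
    ext f
    simp only [Set.mem_image, Set.mem_range, hpow, Set.mem_ofPred_eq]
    constructor
    · rintro ⟨k, ⟨h0, h1, h2, h⟩, rfl⟩
      rw [hγ', div_mul_eq_mul_div, eq_div_iff hm'] at h
      have h' : k 3 * m = l * k 4 := by exact_mod_cast h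
      obtain ⟨n, hn⟩ : l ∣ k 3 := hlm.dvd_of_dvd_mul_right ⟨k 4, h'⟩
      have hn' : k 4 = m * n := by
        apply Nat.eq_of_mul_eq_mul_left hl
        rw [← h', hn]
        ring
      refine ⟨n, ?_⟩
      have hk : Finsupp.single 3 (l * n) + Finsupp.single 4 (m * n) = k := by
        ext i
        fin_cases i <;> simp [h0, h1, h2, hn, hn']
      rw [hk]
    · rintro ⟨n, rfl⟩
      refine ⟨_, ⟨by simp, by simp, by simp, ?_⟩, rfl⟩
      rw [hγ']
      simp
      field_simp
  · intro h
    congr 2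
    ext f
    simp only [Set.mem_image, Set.mem_ofPred_eq, Set.mem_singleton_iff]
    constructor
    · rintro ⟨k, ⟨h0, h1, h2, h3⟩, rfl⟩
      have h4 : k 4 = 0 := by
        by_contra h4
        refine h ⟨k 3, k 4, Nat.pos_of_ne_zero fun hk => ?_, Nat.pos_of_ne_zero h4, ?_⟩
        · rw [hk, Nat.cast_zero, eq_comm] at h3
          exact mul_ne_zero hγ (Nat.cast_ne_zero.mpr h4) h3
        · rw [h3, mul_comm]
      have h3' : k 3 = 0 := by simpa [h4] using h3
      have hk : k = 0 := by
        ext i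
        fin_cases i <;> simp [h0, h1, h2, h3', h4]
      rw [hk]
      rfl
    · rintro rfl
      exact ⟨0, by simp, rfl⟩
end
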